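/- arXiv:2211.15314 — 2 statements merged into one kernel-verified Lean document; each statement's English description precedes it below -/
import Mathlib

section
/- Let G be a simple graph of order n ≥ 1, let k ≥ 2, and let μ_1(G) denote the largest eigenvalue of the Laplacian matrix L(G) = D(G) − A(G). Then the maximum k-cut of G satisfies mc_k(G) ≤ ((k−1)·n/(2k))·μ_1(G). -/
open Finset

/-- The maximum `k`-cut of `G`: the maximum, over all partitions of the vertex set
into `k` (possibly empty) parts, of the number of edges joining distinct parts. -/
def maxKCut {n : ℕ} (G : SimpleGraph (Fin n)) [DecidableRel G.Adj] (k : ℕ) : ℕ :=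
  Finset.univ.sup fun f : Fin n → Fin k =>
    (G.edgeFinset.filter fun e => ¬ (e.map f).IsDiag).card

/-- The Laplacian matrix `L(G) = D(G) - A(G)`. -/
def lap {n : ℕ} (G : SimpleGraph (Fin n)) [DecidableRel G.Adj] :
    Matrix (Fin n) (Fin n) ℝ :=
  Matrix.diagonal (fun v => (G.degree v : ℝ)) - G.adjMatrix ℝ

open Matrix in
/-- The Rayleigh bound: a quadratic form is bounded by any upper bound on its eigenvalues. -/
theorem Matrix.IsHermitian.dotProduct_mulVec_le {ι : Type*} [Fintype ι] [DecidableEq ι]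
    {A : Matrix ι ι ℝ} (hA : A.IsHermitian) {c : ℝ} (hc : ∀ i, hA.eigenvalues i ≤ c)
    (x : ι → ℝ) : x ⬝ᵥ (A *ᵥ x) ≤ c * ∑ i, x i ^ 2 := by
  have hpsd : (c • (1 : Matrix ι ι ℝ) - A).PosSemidef := by
    have hdiag : (diagonal fun i => c - hA.eigenvalues i).PosSemidef :=
      .diagonal fun i => sub_nonneg.mpr (hc i)
    have hconj := hdiag.mul_mul_conjTranspose_same (hA.eigenvectorUnitary : Matrix ι ι ℝ)
    convert hconj using 1
    conv_lhs => rw [hA.spectral_theorem, Unitary.conjStarAlgAut_apply]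
    rw [← diagonal_sub, mul_sub, sub_mul, ← smul_one_eq_diagonal, mul_smul_comm, mul_one,
      smul_mul_assoc, ← star_eq_conjTranspose, Unitary.mul_star_self_of_mem hA.eigenvectorUnitary.2]
    rfl
  have hx := hpsd.dotProduct_mulVec_nonneg x
  simp only [star_trivial, sub_mulVec, smul_mulVec, one_mulVec, dotProduct_sub, dotProduct_smul,
    smul_eq_mul, sub_nonneg] at hx
  simpa only [dotProduct, sq] using hx

/-- The quadratic form of the Laplacian, as a sum over ordered pairs of vertices. -/
theorem dotProduct_lap_mulVec {n : ℕ} (G : SimpleGraph (Fin n)) [DecidableRel G.Adj]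
    (x : Fin n → ℝ) :
    dotProduct x (Matrix.mulVec (lap G) x) =
      (∑ i, ∑ j, if G.Adj i j then (x i - x j) ^ 2 else 0) / 2 := by
  rw [← G.lapMatrix_toLinearMap₂' ℝ x, Matrix.toLinearMap₂'_apply']
  rfl

/-- Twice the size of the cut induced by `f`, as a sum over ordered pairs of vertices. -/
theorem two_mul_card_cut {V α : Type*} [Fintype V] [DecidableEq V] [DecidableEq α]
    (G : SimpleGraph V) [DecidableRel G.Adj] (f : V → α) :
    2 * #{e ∈ G.edgeFinset | ¬ (e.map f).IsDiag} =
      ∑ i, ∑ j, if G.Adj i j ∧ f i ≠ f j then 1 else 0 := by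
  classical
  obtain ⟨H, hH⟩ : ∃ H : SimpleGraph V, ∀ i j, H.Adj i j ↔ G.Adj i j ∧ f i ≠ f j :=
    ⟨G ⊓ (⊤ : SimpleGraph α).comap f, fun i j => by simp⟩
  have hcut : ({e ∈ G.edgeFinset | ¬ (e.map f).IsDiag} : Finset (Sym2 V)) = H.edgeFinset := by
    ext e
    induction e with
    | h i j => simp [hH]
  rw [hcut, SimpleGraph.two_mul_card_edgeFinset, card_filter, ← univ_product_univ, sum_product]
  simp [hH]

theorem sum_sq_indicator_sub {α : Type*} [Fintype α] [DecidableEq α] (a b : α) (c : ℝ) :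
    ∑ i, (((if a = i then 1 else 0) - c) - ((if b = i then 1 else 0) - c)) ^ 2 =
      if a ≠ b then 2 else 0 := by
  have h (i : α) : ((((if a = i then 1 else 0) - c) - ((if b = i then 1 else 0) - c)) ^ 2 : ℝ) =
      (if a = i then 1 else 0) + (if b = i then 1 else 0) -
        2 * (if a = i then (if b = i then 1 else 0) else 0) := by
    split_ifs <;> ring
  simp_rw [h, sum_sub_distrib, sum_add_distrib, ← mul_sum, sum_ite_eq, mem_univ, if_true]
  by_cases hab : a = b
  · simp [hab]; norm_num
  · simp [hab, Ne.symm hab]; norm_num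

theorem sum_sq_centered_indicator {k : ℕ} (hk : k ≠ 0) (a : Fin k) :
    ∑ i, ((if a = i then 1 else 0) - 1 / (k : ℝ)) ^ 2 = ((k : ℝ) - 1) / k := by
  have hk' : (k : ℝ) ≠ 0 := Nat.cast_ne_zero.mpr hk
  have h (i : Fin k) : (((if a = i then 1 else 0) - 1 / (k : ℝ)) ^ 2 : ℝ) =
      (if a = i then 1 - 2 / (k : ℝ) else 0) + 1 / (k : ℝ) ^ 2 := by
    split_ifs <;> ring
  simp_rw [h, sum_add_distrib, sum_ite_eq, mem_univ, if_true, sum_const, card_univ,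
    Fintype.card_fin, nsmul_eq_mul]
  field_simp
  ring

theorem stmt_10 {n : ℕ} (hn : 1 ≤ n) (G : SimpleGraph (Fin n)) [DecidableRel G.Adj]
    (k : ℕ) (hk : 2 ≤ k)
    (hL : (lap G).IsHermitian) :
    (maxKCut G k : ℝ) ≤ (((k : ℝ) - 1) * n / (2 * k)) *
      (Finset.univ.sup' (Finset.univ_nonempty_iff.mpr ⟨⟨0, hn⟩⟩) hL.eigenvalues) := by
  set μ := Finset.univ.sup' (Finset.univ_nonempty_iff.mpr ⟨⟨0, hn⟩⟩) hL.eigenvalues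
  have hμ (i : Fin n) : hL.eigenvalues i ≤ μ := le_sup' _ (mem_univ i)
  have hk₀ : k ≠ 0 := by omega
  have hk' : (k : ℝ) ≠ 0 := Nat.cast_ne_zero.mpr hk₀
  have : Nonempty (Fin k) := ⟨⟨0, by omega⟩⟩
  obtain ⟨f, hf⟩ : ∃ f : Fin n → Fin k,
      maxKCut G k = #{e ∈ G.edgeFinset | ¬ (e.map f).IsDiag} := by
    obtain ⟨f, -, hf⟩ := exists_mem_eq_sup (univ : Finset (Fin n → Fin k)) univ_nonempty
      fun f : Fin n → Fin k =>
        (G.edgeFinset.filter fun e : Sym2 (Fin n) => ¬ (e.map f).IsDiag).card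
    exact ⟨f, hf⟩
  rw [hf]
  let x (i : Fin k) (v : Fin n) : ℝ := (if f v = i then 1 else 0) - 1 / (k : ℝ)
  have hquad : ∑ i, dotProduct (x i) (Matrix.mulVec (lap G) (x i)) =
      2 * (#{e ∈ G.edgeFinset | ¬ (e.map f).IsDiag} : ℝ) := by
    have hcard := congrArg (Nat.cast (R := ℝ)) (two_mul_card_cut G f)
    push_cast at hcard
    rw [hcard]
    simp_rw [dotProduct_lap_mulVec, ← sum_div]
    rw [sum_comm, sum_div]
    refine sum_congr rfl fun u _ => ?_
    rw [sum_comm, sum_div]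
    refine sum_congr rfl fun v _ => ?_
    by_cases huv : G.Adj u v
    · simp only [huv, if_true, true_and, x, sum_sq_indicator_sub]
      split_ifs <;> norm_num
    · simp [huv]
  have hnorm : ∑ i, ∑ v, x i v ^ 2 = n * (((k : ℝ) - 1) / k) := by
    rw [sum_comm]
    simp only [x, sum_sq_centered_indicator hk₀, sum_const, card_univ, Fintype.card_fin,
      nsmul_eq_mul]
  have hbound := sum_le_sum fun i (_ : i ∈ univ) => hL.dotProduct_mulVec_le hμ (x i)
  rw [hquad, ← mul_sum, hnorm] at hbound
  calc (#{e ∈ G.edgeFinset | ¬ (e.map f).IsDiag} : ℝ)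
      ≤ μ * (n * (((k : ℝ) - 1) / k)) / 2 := by linarith
    _ = ((k : ℝ) - 1) * n / (2 * k) * μ := by field_simp
end

section
/- Let G be a simple graph with vertex set V, let k ≥ 2, and let {S_1, ..., S_k} be a partition of V into k nonempty parts. For each i define the vector s^(i) indexed by V with entry −k+1 at vertices of S_i and entry 1 at all other vertices. Then s^(i) is an eigenvector of the signless Laplacian Q(G) = D(G) + A(G) to the eigenvalue q for every i ∈ {1,...,k} if and only if for every i, every vertex v ∈ S_i, and every j ≠ i with j ∈ {1,...,k}, one has d_v(G) + d_v(S_i) − d_v(S_i,S_j) = q. -/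
open Finset

/-- Number of neighbors of `v` (in graph `G`) lying in the set `X`. -/
def degIn {n : ℕ} (G : SimpleGraph (Fin n)) [DecidableRel G.Adj]
    (v : Fin n) (X : Finset (Fin n)) : ℕ :=
  (X.filter fun u => G.Adj v u).card

/-- The signless Laplacian matrix `Q(G) = D(G) + A(G)`. -/
def signlessLap {n : ℕ} (G : SimpleGraph (Fin n)) [DecidableRel G.Adj] :
    Matrix (Fin n) (Fin n) ℝ :=
  Matrix.diagonal (fun v => (G.degree v : ℝ)) + G.adjMatrix ℝ

theorem degIn_eq_sum {n : ℕ} (G : SimpleGraph (Fin n)) [DecidableRel G.Adj]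
    (v : Fin n) (X : Finset (Fin n)) :
    (degIn G v X : ℝ) = ∑ u ∈ G.neighborFinset v, if u ∈ X then (1 : ℝ) else 0 := by
  rw [Finset.sum_boole, degIn]
  congr 2
  ext u
  simp [and_comm]

theorem sum_degIn_eq_degree {n k : ℕ} (G : SimpleGraph (Fin n)) [DecidableRel G.Adj]
    (S : Fin k → Finset (Fin n)) (hdisj : ∀ i j, i ≠ j → Disjoint (S i) (S j))
    (hcover : ∀ v, ∃ i, v ∈ S i) (v : Fin n) :
    ∑ i, (degIn G v (S i) : ℝ) = G.degree v := by
  simp_rw [degIn_eq_sum]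
  rw [Finset.sum_comm, ← G.card_neighborFinset_eq_degree, Finset.cast_card]
  refine Finset.sum_congr rfl fun u _ => ?_
  obtain ⟨i, hi⟩ := hcover u
  rw [Finset.sum_eq_single i (fun j _ hj => if_neg fun h =>
    Finset.disjoint_left.mp (hdisj j i hj) h hi) (by simp), if_pos hi]

theorem signlessLap_mulVec_apply {n : ℕ} (G : SimpleGraph (Fin n)) [DecidableRel G.Adj]
    (X : Finset (Fin n)) (c : ℝ) (f : Fin n → ℝ)
    (hf : ∀ v, f v = if v ∈ X then -c + 1 else 1) (v : Fin n) :
    (signlessLap G).mulVec f v = G.degree v * f v + (G.degree v - c * degIn G v X) := by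
  have hf' : ∀ u, f u = 1 - c * if u ∈ X then (1 : ℝ) else 0 := fun u => by
    rw [hf]; split_ifs <;> ring
  rw [signlessLap, Matrix.add_mulVec, Pi.add_apply, Matrix.mulVec_diagonal,
    SimpleGraph.adjMatrix_mulVec_apply, degIn_eq_sum]
  congr 1
  simp_rw [hf', Finset.sum_sub_distrib, ← Finset.mul_sum]
  simp

theorem stmt_13 {n k : ℕ} (hk : 2 ≤ k) (G : SimpleGraph (Fin n)) [DecidableRel G.Adj]
    (S : Fin k → Finset (Fin n))
    (hdisj : ∀ i j, i ≠ j → Disjoint (S i) (S j))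
    (hcover : ∀ v, ∃ i, v ∈ S i)
    (hne : ∀ i, (S i).Nonempty)
    (s : Fin k → Fin n → ℝ)
    (hs : ∀ i v, s i v = if v ∈ S i then -(k : ℝ) + 1 else 1)
    (q : ℝ) :
    (∀ i, s i ≠ 0 ∧ (signlessLap G).mulVec (s i) = q • s i) ↔
      (∀ i, ∀ v ∈ S i, ∀ j, j ≠ i →
        (G.degree v : ℝ) + (degIn G v (S i) : ℝ) - (degIn G v (S j) : ℝ) = q) := by
  have hk' : (2 : ℝ) ≤ k := by exact_mod_cast hk
  have notMem : ∀ {i j v}, v ∈ S i → j ≠ i → v ∉ S j := fun hv hj h =>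
    Finset.disjoint_left.mp (hdisj _ _ hj) h hv
  constructor
  · intro h i v hv j hj
    have hi := congrFun (h i).2 v
    have hj' := congrFun (h j).2 v
    rw [signlessLap_mulVec_apply G _ k _ (hs _), Pi.smul_apply, smul_eq_mul, hs] at hi hj'
    rw [if_pos hv] at hi
    rw [if_neg (notMem hv hj)] at hj'
    apply mul_left_cancel₀ (show (k : ℝ) ≠ 0 by linarith)
    linarith
  · intro h
    have key : ∀ i, ∀ v ∈ S i,
        ((k : ℝ) - 2) * G.degree v + k * degIn G v (S i) = (k - 1) * q := by
      intro i v hv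
      have hsum : ∑ j, ((G.degree v : ℝ) + degIn G v (S i) - degIn G v (S j) - q) =
          G.degree v - q := by
        rw [Finset.sum_eq_single i (fun j _ hj => sub_eq_zero.mpr (h i v hv j hj)) (by simp)]
        ring
      simp only [Finset.sum_sub_distrib, sum_degIn_eq_degree G S hdisj hcover v,
        Finset.sum_const, Finset.card_univ, Fintype.card_fin, nsmul_eq_mul] at hsum
      linarith
    intro i
    constructor
    · obtain ⟨v, hv⟩ := hne i
      intro h0
      have := congrFun h0 v
      rw [hs, if_pos hv, Pi.zero_apply] at this
      linarith
    · ext v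
      rw [signlessLap_mulVec_apply G _ k _ (hs _), Pi.smul_apply, smul_eq_mul, hs]
      obtain ⟨j, hj⟩ := hcover v
      have hkey := key j v hj
      by_cases hij : i = j
      · subst hij
        rw [if_pos hj]
        linarith
      · rw [if_neg (notMem hj hij)]
        linear_combination (k : ℝ) * h j v hj i hij - hkey
end
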